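/- Let k ≥ 2 and let db be an uncertain database whose facts use only the relation names R_1,…,R_k,S_k of acq_k and which is purified relative to acq_k; let D be the active domain of db. For i = 1,…,k, let type(x_i) = {a ∈ D : there exists a valuation μ over vars(acq_k) with μ(x_i) = a and μ(acq_k) ⊆ db}, and assume type(x_i) ∩ type(x_j) = ∅ whenever i ≠ j. Let G = (V, E) be the directed graph with V = D and E = {(a,b) : R_i(a,b) ∈ db for some i ∈ {1,…,k}}. Then db ∉ CERTAINTY(acq_k) if and only if there exists a function m : V → V such that (v, m(v)) ∈ E for every v ∈ V and there is no fact S_k(a_1,…,a_k) ∈ db with m(a_i) = a_{i+1} for all 1 ≤ i ≤ k−1 and m(a_k) = a_1. -/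

import Mathlib

attribute [local instance] Classical.propDecidable

noncomputable section

/-- A term is either a variable (`Sum.inl v`) or a constant (`Sum.inr c`),
variables and constants both being coded by natural numbers
(the two copies of `ℕ` are disjoint). -/
abbrev Trm := ℕ ⊕ ℕ

/-- A database schema assigns to every relation name (a natural number) an
arity `n` and a primary-key length `k` with `n ≥ k ≥ 1`; the primary key
consists of the first `k` positions. -/
structure Schema where
  arity : ℕ → ℕ
  keyLen : ℕ → ℕ
  keyLen_le_arity : ∀ R, keyLen R ≤ arity R
  one_le_keyLen : ∀ R, 1 ≤ keyLen R

/-- An atom: a relation name together with a list of arguments. -/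
structure Atom where
  rel : ℕ
  args : List Trm
deriving DecidableEq

/-- Variables occurring in a list of terms. -/
def varsL (l : List Trm) : Finset ℕ := (l.filterMap Sum.getLeft?).toFinset

/-- Constants occurring in a list of terms. -/
def constsL (l : List Trm) : Finset ℕ := (l.filterMap Sum.getRight?).toFinset

/-- All variables of an atom. -/
def varsA (A : Atom) : Finset ℕ := varsL A.args

/-- Key variables of an atom: variables in the primary-key positions. -/
def keyVars (S : Schema) (A : Atom) : Finset ℕ := varsL (A.args.take (S.keyLen A.rel))

/-- Constants of an atom. -/
def constsA (A : Atom) : Finset ℕ := constsL A.args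

/-- Well-formed atom: number of arguments equals the arity of its relation name. -/
def wfAtom (S : Schema) (A : Atom) : Prop := A.args.length = S.arity A.rel

/-- A fact is an atom without variables. -/
def isFact (A : Atom) : Prop := ∀ t ∈ A.args, ∃ c : ℕ, t = Sum.inr c

/-- Two (facts) are key-equal: same relation name, and same primary-key positions. -/
def keyEqual (S : Schema) (A B : Atom) : Prop :=
  A.rel = B.rel ∧ A.args.take (S.keyLen A.rel) = B.args.take (S.keyLen B.rel)

/-- The block of `A` in `db`: all facts of `db` key-equal to `A`. -/
def block (S : Schema) (A : Atom) (db : Finset Atom) : Finset Atom :=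
  db.filter (fun B => keyEqual S A B)

/-- An uncertain database: a finite set of well-formed facts. -/
def IsDb (S : Schema) (db : Finset Atom) : Prop := ∀ A ∈ db, isFact A ∧ wfAtom S A

/-- A set of facts is consistent if it contains no two distinct key-equal facts. -/
def Consistent (S : Schema) (db : Finset Atom) : Prop :=
  ∀ A ∈ db, ∀ B ∈ db, keyEqual S A B → A = B

/-- A repair of `db`: a maximal consistent subset of `db`. -/
def IsRepair (S : Schema) (db r : Finset Atom) : Prop :=
  r ⊆ db ∧ Consistent S r ∧
    ∀ r' : Finset Atom, r ⊆ r' → r' ⊆ db → Consistent S r' → r' = r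

/-- Applying a valuation (a total map from variables to constants) to a term. -/
def appT (θ : ℕ → ℕ) : Trm → Trm
  | Sum.inl v => Sum.inr (θ v)
  | Sum.inr c => Sum.inr c

/-- Applying a valuation to an atom. -/
def appA (θ : ℕ → ℕ) (A : Atom) : Atom := ⟨A.rel, A.args.map (appT θ)⟩

/-- Applying a valuation to a query. -/
def appQ (θ : ℕ → ℕ) (q : Finset Atom) : Finset Atom := q.image (appA θ)

/-- `db ⊨ q`: some valuation sends every atom of `q` into `db`. -/
def Sat (db q : Finset Atom) : Prop := ∃ θ : ℕ → ℕ, appQ θ q ⊆ db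

/-- `db ∈ CERTAINTY(q)`: every repair of `db` satisfies `q`. -/
def Certainty (S : Schema) (q db : Finset Atom) : Prop :=
  ∀ r : Finset Atom, IsRepair S db r → Sat r q

/-- Variables of a query. -/
def varsQ (q : Finset Atom) : Finset ℕ := q.biUnion varsA

/-- Constants of a query. -/
def constsQ (q : Finset Atom) : Finset ℕ := q.biUnion constsA

/-- `q` has no self-join: no two distinct atoms share a relation name. -/
def NoSelfJoin (q : Finset Atom) : Prop := ∀ F ∈ q, ∀ G ∈ q, F.rel = G.rel → F = G

/-- `db` is purified relative to `q`. -/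
def Purified (q db : Finset Atom) : Prop :=
  ∀ A ∈ db, ∃ θ : ℕ → ℕ, A ∈ appQ θ q ∧ appQ θ q ⊆ db

/-- Active domain of a database: all constants occurring in its facts. -/
def adom (db : Finset Atom) : Finset ℕ := db.biUnion constsA

/-- Membership in the attribute closure of `X` under a set `FDs` of
functional dependencies (standard implication of functional dependencies). -/
inductive InCl (FDs : Set (Finset ℕ × Finset ℕ)) (X : Finset ℕ) : ℕ → Prop
  | base {x : ℕ} : x ∈ X → InCl FDs X x
  | step {Z W : Finset ℕ} {w : ℕ} : (Z, W) ∈ FDs → (∀ z ∈ Z, InCl FDs X z) →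
      w ∈ W → InCl FDs X w

/-- `FDs ⊨ X → Y`. -/
def FDImp (FDs : Set (Finset ℕ × Finset ℕ)) (X Y : Finset ℕ) : Prop :=
  ∀ y ∈ Y, InCl FDs X y

/-- `FD(q) = { key(F) → vars(F) : F ∈ q }`. -/
def FDq (S : Schema) (q : Finset Atom) : Set (Finset ℕ × Finset ℕ) :=
  {p | ∃ F ∈ q, p = (keyVars S F, varsA F)}

/-- `F^{+,q} = {x ∈ vars(q) : FD(q \ {F}) ⊨ key(F) → x}`. -/
def plusCl (S : Schema) (q : Finset Atom) (F : Atom) : Set ℕ :=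
  {x | x ∈ varsQ q ∧ InCl (FDq S (q.erase F)) (keyVars S F) x}

/-- `F^{⊕,q} = {x ∈ vars(q) : FD(q) ⊨ key(F) → x}`. -/
def oplusCl (S : Schema) (q : Finset Atom) (F : Atom) : Set ℕ :=
  {x | x ∈ varsQ q ∧ InCl (FDq S q) (keyVars S F) x}

/-- A (simple) path in an undirected graph given by edge relation `E`. -/
def IsPath (E : Atom → Atom → Prop) (p : List Atom) : Prop :=
  p ≠ [] ∧ p.Nodup ∧ List.Chain' E p

/-- `E` is (the edge relation of) a join tree for `q`: a tree (unique simple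
paths between any two vertices) on the atoms of `q` satisfying the
Connectedness Condition. -/
def IsJoinTree (q : Finset Atom) (E : Atom → Atom → Prop) : Prop :=
  (∀ a b, E a b → E b a) ∧
  (∀ a b, E a b → a ∈ q ∧ b ∈ q ∧ a ≠ b) ∧
  (∀ a ∈ q, ∀ b ∈ q, ∃! p : List Atom,
      IsPath E p ∧ p.head? = some a ∧ p.getLast? = some b) ∧
  (∀ x : ℕ, ∀ F ∈ q, ∀ G ∈ q, x ∈ varsA F → x ∈ varsA G →
      ∀ p : List Atom, IsPath E p → p.head? = some F → p.getLast? = some G →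
        ∀ H ∈ p, x ∈ varsA H)

/-- The consecutive pairs (edges) of a path. -/
def edgePairs (p : List Atom) : List (Atom × Atom) := p.zip p.tail

/-- `F ↝ G` in the attack graph of the join tree `E` of `q`: `F ≠ G` are atoms
of `q`, and no label `vars(H) ∩ vars(H')` of an edge on the (unique) path from
`F` to `G` is contained in `F^{+,q}`. -/
def Attacks (S : Schema) (q : Finset Atom) (E : Atom → Atom → Prop) (F G : Atom) : Prop :=
  F ∈ q ∧ G ∈ q ∧ F ≠ G ∧
  ∀ p : List Atom, IsPath E p → p.head? = some F → p.getLast? = some G →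
    ∀ e ∈ edgePairs p, ¬ ((↑(varsA e.1 ∩ varsA e.2) : Set ℕ) ⊆ plusCl S q F)

/-- The attack `F ↝ G` is weak: `key(G) ⊆ F^{⊕,q}`. -/
def Weak (S : Schema) (q : Finset Atom) (F G : Atom) : Prop :=
  (↑(keyVars S G) : Set ℕ) ⊆ oplusCl S q F

/-- Consecutive pairs of a cyclic sequence, including the wrap-around pair. -/
def cyclePairs (L : List Atom) : List (Atom × Atom) := L.zip (L.rotate 1)

/-- `L` is an (elementary directed) cycle in the directed graph `att`. -/
def IsCycle (att : Atom → Atom → Prop) (L : List Atom) : Prop :=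
  2 ≤ L.length ∧ L.Nodup ∧ ∀ e ∈ cyclePairs L, att e.1 e.2

/-- A cycle is terminal: no edge leads from a vertex in the cycle to a vertex
outside the cycle. -/
def TerminalCycle (att : Atom → Atom → Prop) (L : List Atom) : Prop :=
  ∀ a ∈ L, ∀ b, att a b → b ∈ L

/-- A strong cycle in the attack graph: a cycle at least one attack of which is strong. -/
def StrongCycle (S : Schema) (q : Finset Atom) (E : Atom → Atom → Prop)
    (L : List Atom) : Prop :=
  IsCycle (Attacks S q E) L ∧ ∃ e ∈ cyclePairs L, ¬ Weak S q e.1 e.2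

/-- Substituting constant `c` for variable `z` in a term. -/
def substT (z c : ℕ) : Trm → Trm
  | Sum.inl v => if v = z then Sum.inr c else Sum.inl v
  | Sum.inr d => Sum.inr d

/-- `F[z→c]`. -/
def substA (z c : ℕ) (A : Atom) : Atom := ⟨A.rel, A.args.map (substT z c)⟩

/-- `q[z→c]`. -/
def substQ (z c : ℕ) (q : Finset Atom) : Finset Atom := q.image (substA z c)

/-- Simultaneous substitution of the constants `bs` for the (distinct)
variables `xs` (componentwise) in a term. -/
def substLT (xs bs : List ℕ) : Trm → Trm
  | Sum.inl v => if v ∈ xs then Sum.inr (bs.getD (xs.idxOf v) 0) else Sum.inl v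
  | Sum.inr d => Sum.inr d

/-- `F[x⃗→b⃗]`. -/
def substLA (xs bs : List ℕ) (A : Atom) : Atom := ⟨A.rel, A.args.map (substLT xs bs)⟩

/-- `q[x⃗→b⃗]`. -/
def substLQ (xs bs : List ℕ) (q : Finset Atom) : Finset Atom := q.image (substLA xs bs)

/-- First-order formulas over the relational vocabulary (relation names and
constants coded by naturals, variables coded by naturals). -/
inductive Fml where
  | atom (R : ℕ) (args : List Trm)
  | eq (s t : Trm)
  | tru
  | not (φ : Fml)
  | and (φ ψ : Fml)
  | or (φ ψ : Fml)
  | ex (v : ℕ) (φ : Fml)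
  | all (v : ℕ) (φ : Fml)

/-- Value of a term under an assignment of constants to variables. -/
def evalT (σ : ℕ → ℕ) : Trm → ℕ
  | Sum.inl v => σ v
  | Sum.inr c => c

/-- Satisfaction of a first-order formula in the finite structure whose
relations are given by the facts of `db`, with quantifiers ranging over `dom`. -/
def Holds (db : Finset Atom) (dom : Finset ℕ) : Fml → (ℕ → ℕ) → Prop
  | .atom R args, σ => (⟨R, args.map fun t => Sum.inr (evalT σ t)⟩ : Atom) ∈ db
  | .eq s t, σ => evalT σ s = evalT σ t
  | .tru, _ => True
  | .not φ, σ => ¬ Holds db dom φ σ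
  | .and φ ψ, σ => Holds db dom φ σ ∧ Holds db dom ψ σ
  | .or φ ψ, σ => Holds db dom φ σ ∨ Holds db dom ψ σ
  | .ex v φ, σ => ∃ a ∈ dom, Holds db dom φ (Function.update σ v a)
  | .all v φ, σ => ∀ a ∈ dom, Holds db dom φ (Function.update σ v a)

/-- Free variables of a formula. -/
def Fml.free : Fml → Finset ℕ
  | .atom _ args => varsL args
  | .eq s t => varsL [s, t]
  | .tru => ∅
  | .not φ => φ.free
  | .and φ ψ => φ.free ∪ ψ.free
  | .or φ ψ => φ.free ∪ ψ.free
  | .ex v φ => φ.free.erase v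
  | .all v φ => φ.free.erase v

/-- Relation names occurring in a formula. -/
def Fml.rels : Fml → Finset ℕ
  | .atom R _ => {R}
  | .eq _ _ => ∅
  | .tru => ∅
  | .not φ => φ.rels
  | .and φ ψ => φ.rels ∪ ψ.rels
  | .or φ ψ => φ.rels ∪ ψ.rels
  | .ex _ φ => φ.rels
  | .all _ φ => φ.rels

/-- Constants occurring in a formula. -/
def Fml.consts : Fml → Finset ℕ
  | .atom _ args => constsL args
  | .eq s t => constsL [s, t]
  | .tru => ∅
  | .not φ => φ.consts
  | .and φ ψ => φ.consts ∪ ψ.consts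
  | .or φ ψ => φ.consts ∪ ψ.consts
  | .ex _ φ => φ.consts
  | .all _ φ => φ.consts

/-- Well-formed formula: every atom has as many arguments as the arity of its
relation name. -/
def FmlWf (S : Schema) : Fml → Prop
  | .atom R args => args.length = S.arity R
  | .eq _ _ => True
  | .tru => True
  | .not φ => FmlWf S φ
  | .and φ ψ => FmlWf S φ ∧ FmlWf S ψ
  | .or φ ψ => FmlWf S φ ∧ FmlWf S ψ
  | .ex _ φ => FmlWf S φ
  | .all _ φ => FmlWf S φ

/-- The safety predicate of Dalvi, Ré and Suciu (rules SE1–SE4). -/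
inductive Safe (S : Schema) : Finset Atom → Prop
  | se1 (A : Atom) : isFact A → Safe S {A}
  | se2 (q₁ q₂ : Finset Atom) : q₁.Nonempty → q₂.Nonempty →
      Disjoint (varsQ q₁) (varsQ q₂) → Safe S q₁ → Safe S q₂ → Safe S (q₁ ∪ q₂)
  | se3 (q : Finset Atom) (x a : ℕ) : (∀ F ∈ q, x ∈ keyVars S F) →
      Safe S (substQ x a q) → Safe S q
  | se4 (q : Finset Atom) (F : Atom) (x a : ℕ) : F ∈ q → keyVars S F = ∅ →
      varsA F ≠ ∅ → x ∈ varsA F → Safe S (substQ x a q) → Safe S q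

/-- The atom `R_i(x_i ; x_{i+1})` (with `x_{k+1} = x_1`) of the query `acq_k`;
variable `x_i` is coded by `i`, relation name `R_i` by `i`. -/
def Ratom (k i : ℕ) : Atom := ⟨i, [Sum.inl i, Sum.inl (i % k + 1)]⟩

/-- The all-key atom `S_k(x_1,…,x_k)` of the query `acq_k`;
relation name `S_k` is coded by `0`. -/
def Satom (k : ℕ) : Atom := ⟨0, (List.range k).map (fun j => Sum.inl (j + 1))⟩

/-- The query `acq_k = {R_1(x_1;x_2), …, R_k(x_k;x_1), S_k(x_1,…,x_k)}`. -/
def acq (k : ℕ) : Finset Atom := ((Finset.Icc 1 k).image (Ratom k)) ∪ {Satom k}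

/-- Sum of `Pr` over the possible (= consistent) worlds of `db` satisfying `P`. -/
def prOf (S : Schema) (db : Finset Atom) (Pr : Finset Atom → ℚ)
    (P : Finset Atom → Prop) : ℚ :=
  ∑ w ∈ db.powerset.filter (fun w => Consistent S w ∧ P w), Pr w

end
theorem appQ_acq_sub (k : ℕ) (μ : ℕ → ℕ) (X : Finset Atom) :
    appQ μ (acq k) ⊆ X ↔
      (∀ i, 1 ≤ i → i ≤ k → (⟨i, [Sum.inr (μ i), Sum.inr (μ (i % k + 1))]⟩ : Atom) ∈ X) ∧
      (⟨0, List.ofFn (fun j : Fin k => (Sum.inr (μ (j.val + 1)) : Trm))⟩ : Atom) ∈ X := by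
  have hs : appA μ (Satom k) =
      ⟨0, List.ofFn (fun j : Fin k => (Sum.inr (μ (j.val + 1)) : Trm))⟩ := by
    simp only [appA, Satom, Atom.mk.injEq, true_and]
    apply List.ext_getElem
    · simp
    · intro n h1 h2
      simp [appT]
  rw [← hs]
  constructor
  · intro h
    refine ⟨fun i h1 h2 => ?_, ?_⟩
    · apply h
      refine Finset.mem_image.2 ⟨Ratom k i, ?_, by simp [appA, Ratom, appT]⟩
      exact Finset.mem_union_left _ (Finset.mem_image_of_mem _ (Finset.mem_Icc.2 ⟨h1, h2⟩))
    · apply h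
      exact Finset.mem_image_of_mem _ (Finset.mem_union_right _ (Finset.mem_singleton_self _))
  · rintro ⟨h1, h2⟩ A hA
    obtain ⟨F, hF, rfl⟩ := Finset.mem_image.1 hA
    rcases Finset.mem_union.1 hF with hF | hF
    · obtain ⟨i, hi, rfl⟩ := Finset.mem_image.1 hF
      have := Finset.mem_Icc.1 hi
      have := h1 i this.1 this.2
      simpa [appA, Ratom, appT] using this
    · rw [Finset.mem_singleton.1 hF]
      exact h2

theorem mem_appQ_acq (k : ℕ) (μ : ℕ → ℕ) (A : Atom) (h : A ∈ appQ μ (acq k)) :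
    (∃ i, 1 ≤ i ∧ i ≤ k ∧ A = ⟨i, [Sum.inr (μ i), Sum.inr (μ (i % k + 1))]⟩) ∨
      A = ⟨0, List.ofFn (fun j : Fin k => (Sum.inr (μ (j.val + 1)) : Trm))⟩ := by
  have key := (appQ_acq_sub k μ
    (((Finset.Icc 1 k).image (fun i => (⟨i, [Sum.inr (μ i), Sum.inr (μ (i % k + 1))]⟩ : Atom)))
      ∪ {⟨0, List.ofFn (fun j : Fin k => (Sum.inr (μ (j.val + 1)) : Trm))⟩})).2
    ⟨fun i h1 h2 => Finset.mem_union_left _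
        (Finset.mem_image.2 ⟨i, Finset.mem_Icc.2 ⟨h1, h2⟩, rfl⟩),
      Finset.mem_union_right _ (Finset.mem_singleton_self _)⟩ h
  rcases Finset.mem_union.1 key with h | h
  · obtain ⟨i, hi, rfl⟩ := Finset.mem_image.1 h
    have := Finset.mem_Icc.1 hi
    exact Or.inl ⟨i, this.1, this.2, rfl⟩
  · exact Or.inr (Finset.mem_singleton.1 h)

theorem atom_eq {A B : Atom} (h1 : A.rel = B.rel) (h2 : A.args = B.args) : A = B := by
  cases A
  cases B
  simp only at h1 h2
  rw [h1, h2]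

theorem keyEqual_comm' {S : Schema} {A B : Atom} (h : keyEqual S A B) : keyEqual S B A :=
  ⟨h.1.symm, h.2.symm⟩

theorem repair_meets {S : Schema} {db r : Finset Atom} (h : IsRepair S db r) {A : Atom}
    (hA : A ∈ db) : ∃ B ∈ r, keyEqual S A B := by
  by_contra hc
  push Not at hc
  have := h.2.2 (insert A r) (Finset.subset_insert _ _)
    (Finset.insert_subset hA h.1) (by
      intro X hX Y hY hXY
      rcases Finset.mem_insert.1 hX with rfl | hX'
      · rcases Finset.mem_insert.1 hY with rfl | hY
        · rfl
        · exact absurd hXY (hc _ hY)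
      · rcases Finset.mem_insert.1 hY with rfl | hY
        · exact absurd (keyEqual_comm' hXY) (hc _ hX')
        · exact h.2.1 _ hX' _ hY hXY)
  exact hc A (this ▸ Finset.mem_insert_self A r) ⟨rfl, rfl⟩

theorem mem_constsA (A : Atom) (v : ℕ) : v ∈ constsA A ↔ Sum.inr v ∈ A.args := by
  simp [constsA, constsL, List.mem_filterMap]

/-- For `k ≥ 2` and `db` purified relative to `acq_k` with
pairwise disjoint types, `db ∉ CERTAINTY(acq_k)` iff one can choose one
outgoing `R`-edge `m(v)` for every active-domain element `v` without choosing
all edges of some cycle `a_1 → … → a_k → a_1` recorded in `S_k`. -/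
theorem statement16 (k : ℕ) (hk : 2 ≤ k) (S : Schema)
    (hS0a : S.arity 0 = k) (hS0k : S.keyLen 0 = k)
    (hSRa : ∀ i : ℕ, 1 ≤ i → i ≤ k → S.arity i = 2 ∧ S.keyLen i = 1)
    (db : Finset Atom) (hdb : IsDb S db)
    (hrels : ∀ A ∈ db, A.rel ≤ k)
    (hpur : Purified (acq k) db)
    (htype : ∀ i j : ℕ, 1 ≤ i → i ≤ k → 1 ≤ j → j ≤ k → i ≠ j →
      ∀ a : ℕ, ¬ ((∃ μ : ℕ → ℕ, μ i = a ∧ appQ μ (acq k) ⊆ db) ∧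
                  (∃ μ : ℕ → ℕ, μ j = a ∧ appQ μ (acq k) ⊆ db))) :
    ¬ Certainty S (acq k) db ↔
      ∃ m : ℕ → ℕ,
        (∀ v ∈ adom db, ∃ i : ℕ, 1 ≤ i ∧ i ≤ k ∧
          (⟨i, [Sum.inr v, Sum.inr (m v)]⟩ : Atom) ∈ db) ∧
        ¬ ∃ a : Fin k → ℕ,
          (⟨0, List.ofFn (fun j : Fin k => (Sum.inr (a j) : Trm))⟩ : Atom) ∈ db ∧
          ∀ j : Fin k, m (a j) = a ⟨(j.val + 1) % k, Nat.mod_lt _ (by omega)⟩ := by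
  have hk0 : 0 < k := by omega
  have hR : ∀ i a b, 1 ≤ i → (⟨i, [Sum.inr a, Sum.inr b]⟩ : Atom) ∈ db →
      i ≤ k ∧ ∃ μ : ℕ → ℕ, μ i = a ∧ appQ μ (acq k) ⊆ db := by
    intro i a b hi h
    obtain ⟨μ, h1, h2⟩ := hpur _ h
    rcases mem_appQ_acq k μ _ h1 with ⟨j, hj1, hj2, he⟩ | he
    · simp only [Atom.mk.injEq, List.cons.injEq, Sum.inr.injEq] at he
      obtain ⟨rfl, rfl, -⟩ := he
      exact ⟨hj2, μ, rfl, h2⟩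
    · simp only [Atom.mk.injEq] at he
      omega
  have huniq : ∀ i j a b c, 1 ≤ i → 1 ≤ j → (⟨i, [Sum.inr a, Sum.inr b]⟩ : Atom) ∈ db →
      (⟨j, [Sum.inr a, Sum.inr c]⟩ : Atom) ∈ db → i = j := by
    intro i j a b c hi hj h1 h2
    by_contra hne
    obtain ⟨hik, h1⟩ := hR _ _ _ hi h1
    obtain ⟨hjk, h2⟩ := hR _ _ _ hj h2
    exact htype i j hi hik hj hjk hne a ⟨h1, h2⟩
  have hform : ∀ A ∈ db, A.rel ≠ 0 → ∃ a b, A = ⟨A.rel, [Sum.inr a, Sum.inr b]⟩ := by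
    intro A hA h0
    obtain ⟨μ, h1, h2⟩ := hpur _ hA
    rcases mem_appQ_acq k μ _ h1 with ⟨j, hj1, hj2, rfl⟩ | rfl
    · exact ⟨_, _, rfl⟩
    · exact absurd rfl h0
  have hlen : ∀ A ∈ db, A.rel = 0 → A.args.length = k := by
    intro A hA h0
    rw [(hdb A hA).2, h0, hS0a]
  have hkeyS : ∀ A ∈ db, ∀ B ∈ db, A.rel = 0 → keyEqual S A B → A = B := by
    intro A hA B hB h0 h
    have h0' : B.rel = 0 := h.1 ▸ h0
    have := h.2
    rw [h0, h0', hS0k, List.take_of_length_le (hlen A hA h0).le,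
      List.take_of_length_le (hlen B hB h0').le] at this
    exact atom_eq h.1 this
  have hdom : ∀ v ∈ adom db, ∃ i b, 1 ≤ i ∧ i ≤ k ∧
      (⟨i, [Sum.inr v, Sum.inr b]⟩ : Atom) ∈ db := by
    intro v hv
    obtain ⟨A, hA, hv⟩ := Finset.mem_biUnion.1 hv
    rw [mem_constsA] at hv
    obtain ⟨μ, h1, h2⟩ := hpur _ hA
    have h3 := ((appQ_acq_sub k μ db).1 h2).1
    have : ∃ i, 1 ≤ i ∧ i ≤ k ∧ v = μ i := by
      rcases mem_appQ_acq k μ _ h1 with ⟨j, hj1, hj2, rfl⟩ | rfl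
      · simp only [List.mem_cons, Sum.inr.injEq, List.not_mem_nil, or_false] at hv
        rcases hv with rfl | rfl
        · exact ⟨j, hj1, hj2, rfl⟩
        · exact ⟨j % k + 1, by omega, Nat.mod_lt _ hk0, rfl⟩
      · simp only [List.mem_ofFn, Sum.inr.injEq] at hv
        obtain ⟨j, hj⟩ := hv
        exact ⟨j.val + 1, by omega, j.isLt, hj.symm⟩
    obtain ⟨i, hi1, hi2, rfl⟩ := this
    exact ⟨i, _, hi1, hi2, h3 i hi1 hi2⟩
  have hadom : ∀ i a b, (⟨i, [Sum.inr a, Sum.inr b]⟩ : Atom) ∈ db → a ∈ adom db := by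
    intro i a b h
    exact Finset.mem_biUnion.2 ⟨_, h, (mem_constsA _ _).2 (by simp)⟩
  constructor
  · intro hnc
    simp only [Certainty, not_forall] at hnc
    obtain ⟨r, hr, hns⟩ := hnc
    have hex : ∀ v, ∃ b, v ∈ adom db →
        ∃ i, 1 ≤ i ∧ i ≤ k ∧ (⟨i, [Sum.inr v, Sum.inr b]⟩ : Atom) ∈ r := by
      intro v
      by_cases hv : v ∈ adom db
      · obtain ⟨i, b, hi1, hi2, hm⟩ := hdom v hv
        obtain ⟨B, hB, hke⟩ := repair_meets hr hm
        have hrel : B.rel = i := hke.1.symm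
        obtain ⟨a, c, hBe⟩ := hform B (hr.1 hB) (by omega)
        rw [hrel] at hBe
        subst hBe
        have h2 := hke.2
        simp only [(hSRa i hi1 hi2).2, List.take_succ_cons, List.take_zero, List.cons.injEq,
          Sum.inr.injEq, and_true] at h2
        subst h2
        exact ⟨c, fun _ => ⟨i, hi1, hi2, hB⟩⟩
      · exact ⟨0, fun h => absurd h hv⟩
    choose m hm using hex
    refine ⟨m, fun v hv => ?_, ?_⟩
    · obtain ⟨i, h1, h2, h3⟩ := hm v hv
      exact ⟨i, h1, h2, hr.1 h3⟩
    · rintro ⟨a, haS, ham⟩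
      apply hns
      obtain ⟨μ, h1, h2⟩ := hpur _ haS
      have hA : ∀ j : Fin k, a j = μ (j.val + 1) := by
        rcases mem_appQ_acq k μ _ h1 with ⟨j, hj1, hj2, he⟩ | he
        · simp only [Atom.mk.injEq] at he
          omega
        · simp only [Atom.mk.injEq, true_and] at he
          intro j
          have := congrFun (List.ofFn_injective he) j
          simpa using this
      refine ⟨μ, (appQ_acq_sub k μ r).2 ⟨fun i hi1 hi2 => ?_, ?_⟩⟩
      · have h3 := ((appQ_acq_sub k μ db).1 h2).1 i hi1 hi2
        obtain ⟨i', hi1', hi2', h4⟩ := hm (μ i) (hadom _ _ _ h3)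
        have hii := huniq _ _ _ _ _ hi1 hi1' h3 (hr.1 h4)
        subst hii
        have h5 := ham ⟨i - 1, by omega⟩
        rw [hA, hA] at h5
        simp only [Nat.sub_add_cancel hi1] at h5
        rw [h5] at h4
        exact h4
      · have h3 := ((appQ_acq_sub k μ db).1 h2).2
        obtain ⟨B, hB, hke⟩ := repair_meets hr h3
        rw [hkeyS _ h3 B (hr.1 hB) rfl hke]
        exact hB
  · rintro ⟨m, hm, hno⟩ hc
    obtain ⟨μ, hμ⟩ := hc
      (db.filter (fun A => A.rel = 0 ∨ ∃ v, A.args = [Sum.inr v, Sum.inr (m v)])) (by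
        refine ⟨Finset.filter_subset _ _, ?_, ?_⟩
        · intro A hA B hB hke
          obtain ⟨hA, hA'⟩ := Finset.mem_filter.1 hA
          obtain ⟨hB, hB'⟩ := Finset.mem_filter.1 hB
          by_cases h0 : A.rel = 0
          · exact hkeyS A hA B hB h0 hke
          · have h0' : B.rel ≠ 0 := hke.1 ▸ h0
            obtain ⟨v, hv⟩ := hA'.resolve_left h0
            obtain ⟨w, hw⟩ := hB'.resolve_left h0'
            have h2 := hke.2
            rw [hv, hw, (hSRa _ (Nat.pos_of_ne_zero h0) (hrels A hA)).2,
              (hSRa _ (Nat.pos_of_ne_zero h0') (hrels B hB)).2] at h2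
            simp only [List.take_succ_cons, List.take_zero, List.cons.injEq,
              Sum.inr.injEq, and_true] at h2
            subst h2
            exact atom_eq hke.1 (hv.trans hw.symm)
        · intro r' hsub hsub' hcons
          refine Finset.Subset.antisymm (fun A hA => ?_) hsub
          have hAdb := hsub' hA
          by_cases h0 : A.rel = 0
          · exact Finset.mem_filter.2 ⟨hAdb, Or.inl h0⟩
          · obtain ⟨a, b, hAe⟩ := hform A hAdb h0
            have hpos := Nat.pos_of_ne_zero h0
            have hAdb' := hAdb
            rw [hAe] at hAdb'
            obtain ⟨i, hi1, hi2, hi⟩ := hm a (hadom _ _ _ hAdb')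
            have hii := huniq _ _ _ _ _ hpos hi1 hAdb' hi
            have hmem : (⟨i, [Sum.inr a, Sum.inr (m a)]⟩ : Atom) ∈
                db.filter (fun A => A.rel = 0 ∨ ∃ v, A.args = [Sum.inr v, Sum.inr (m v)]) :=
              Finset.mem_filter.2 ⟨hi, Or.inr ⟨a, rfl⟩⟩
            have := hcons A hA _ (hsub hmem) (by
              rw [hAe]
              refine ⟨hii, ?_⟩
              simp only [hii, (hSRa i hi1 hi2).2, List.take_succ_cons, List.take_zero])
            rw [this]
            exact hmem)
    obtain ⟨h1, h2⟩ := (appQ_acq_sub k μ _).1 hμ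
    apply hno
    refine ⟨fun j => μ (j.val + 1), (Finset.mem_filter.1 h2).1, fun j => ?_⟩
    have h3 := (Finset.mem_filter.1 (h1 (j.val + 1) (by omega) j.isLt)).2
    obtain ⟨v, hv⟩ := h3.resolve_left (by simp)
    simp only [List.cons.injEq, Sum.inr.injEq, and_true] at hv
    obtain ⟨rfl, hv⟩ := hv
    exact hv.symm
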